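/- Let N ≥ 1, let y ∈ ℝ^N, and let g* be the isotonic least-squares fit of y. For every consecutive-block partition of {1,…,N} whose block means are nondecreasing (P̂_1 ≤ P̂_2 ≤ ⋯ ≤ P̂_B), the binning criterion of the partition is at least (1/N)·∑_{i=1}^{N}(y_i − g*_i)². -/

import Mathlib

open Finset

/-- Mean of `y` over the consecutive block `[a, c)`. -/
noncomputable def blockMean (y : ℕ → ℝ) (a c : ℕ) : ℝ :=
  (∑ i ∈ Finset.Ico a c, y i) / ((c - a : ℕ) : ℝ)

/-- Within-block variance of `y` over the consecutive block `[a, c)`. -/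
noncomputable def blockVar (y : ℕ → ℝ) (a c : ℕ) : ℝ :=
  (∑ i ∈ Finset.Ico a c, (y i - blockMean y a c) ^ 2) / ((c - a : ℕ) : ℝ)

/-- The binning criterion of the consecutive-block partition of `{0, …, N-1}`
with cut indices `n 0 = 0 < n 1 < ⋯ < n B = N`:
the weighted (by block size over `N`) sum of within-block variances. -/
noncomputable def binCrit (y : ℕ → ℝ) (N B : ℕ) (n : ℕ → ℕ) : ℝ :=
  ∑ b ∈ Finset.range B,
    (((n (b + 1) - n b : ℕ) : ℝ) / (N : ℝ)) * blockVar y (n b) (n (b + 1))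

/-- `n` is a sequence of cut indices for a consecutive-block partition of
`{0, …, N-1}` into `B` blocks. -/
def IsCutSeq (N B : ℕ) (n : ℕ → ℕ) : Prop :=
  n 0 = 0 ∧ n B = N ∧ ∀ b < B, n b < n (b + 1)

/-- `g` is nondecreasing on the index range `{0, …, N-1}`. -/
def MonotoneOnRange (N : ℕ) (g : ℕ → ℝ) : Prop :=
  ∀ i j : ℕ, i ≤ j → j < N → g i ≤ g j

/-- `g` is an isotonic least-squares fit of `y` on `{0, …, N-1}`: it is
nondecreasing and minimises the squared Euclidean distance to `y` over all
nondecreasing vectors. -/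
def IsIsotonicFit (N : ℕ) (y g : ℕ → ℝ) : Prop :=
  MonotoneOnRange N g ∧
    ∀ h : ℕ → ℝ, MonotoneOnRange N h →
      ∑ i ∈ Finset.range N, (y i - g i) ^ 2 ≤ ∑ i ∈ Finset.range N, (y i - h i) ^ 2

/-- The cut sequence `n` lists the maximal constant blocks of `g` on
`{0, …, N-1}` in increasing order: `g` is constant on each block and its value
changes across every interior boundary. -/
def IsMaxBlockPartition (N B : ℕ) (g : ℕ → ℝ) (n : ℕ → ℕ) : Prop :=
  IsCutSeq N B n ∧
    (∀ b < B, ∀ i ∈ Finset.Ico (n b) (n (b + 1)), ∀ j ∈ Finset.Ico (n b) (n (b + 1)), g i = g j) ∧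
    (∀ b, 0 < b → b < B → g (n b - 1) ≠ g (n b))

/-- Cut indices are nondecreasing up to the last one. -/
theorem IsCutSeq.le_of_le {N B : ℕ} {n : ℕ → ℕ} (hcut : IsCutSeq N B n) {b c : ℕ}
    (hbc : b ≤ c) (hc : c ≤ B) : n b ≤ n c := by
  induction c, hbc using Nat.le_induction with
  | base => exact le_rfl
  | succ k _ ih => exact (ih (by omega)).trans (hcut.2.2 k (by omega)).le

/-- A sum over `{0, …, N-1}` splits into the sums over the blocks. -/
theorem IsCutSeq.sum_range_eq {N B : ℕ} {n : ℕ → ℕ} (hcut : IsCutSeq N B n) (f : ℕ → ℝ) :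
    ∑ i ∈ Finset.range N, f i =
      ∑ b ∈ Finset.range B, ∑ i ∈ Finset.Ico (n b) (n (b + 1)), f i := by
  have key : ∀ k ≤ B, ∑ i ∈ Finset.range (n k), f i =
      ∑ b ∈ Finset.range k, ∑ i ∈ Finset.Ico (n b) (n (b + 1)), f i := by
    intro k
    induction k with
    | zero => simp [hcut.1]
    | succ k ih =>
      intro hk
      rw [Finset.sum_range_succ, ← ih (by omega),
        Finset.sum_range_add_sum_Ico f (hcut.2.2 k (by omega)).le]
  simpa [hcut.2.1] using key B le_rfl

/-- The index of the block containing `i`, for a partition into `B` blocks with cuts `n`. -/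
def blockIndex (B : ℕ) (n : ℕ → ℕ) (i : ℕ) : ℕ :=
  Nat.findGreatest (fun b => n b ≤ i) (B - 1)

theorem blockIndex_mono (B : ℕ) (n : ℕ → ℕ) : Monotone (blockIndex B n) :=
  fun _ _ hij => Nat.findGreatest_mono_left (fun _ hb => le_trans hb hij) _

theorem IsCutSeq.blockIndex_eq {N B : ℕ} {n : ℕ → ℕ} (hcut : IsCutSeq N B n) {b i : ℕ}
    (hb : b < B) (hi : i ∈ Finset.Ico (n b) (n (b + 1))) : blockIndex B n i = b := by
  rw [Finset.mem_Ico] at hi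
  refine Nat.findGreatest_eq_iff.2 ⟨by omega, fun _ => hi.1, fun c hbc hc => ?_⟩
  have := hcut.le_of_le (b := b + 1) (c := c) hbc (by omega)
  omega

/-- The step vector taking nondecreasing values on successive blocks is nondecreasing. -/
theorem monotoneOnRange_comp_blockIndex {N B : ℕ} (n : ℕ → ℕ) {m : ℕ → ℝ} (hB : 1 ≤ B)
    (hm : ∀ b, b + 1 < B → m b ≤ m (b + 1)) :
    MonotoneOnRange N (fun i => m (blockIndex B n i)) := by
  have key : ∀ b c, b ≤ c → c < B → m b ≤ m c := by
    intro b c hbc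
    induction c, hbc using Nat.le_induction with
    | base => exact fun _ => le_rfl
    | succ k _ ih => exact fun hk => (ih (by omega)).trans (hm k hk)
  intro i j hij _
  have hj : blockIndex B n j ≤ B - 1 := Nat.findGreatest_le _
  exact key _ _ (blockIndex_mono B n hij) (by omega)

/-- The binning criterion is the mean squared distance from `y` to its vector of block means. -/
theorem IsCutSeq.binCrit_eq {N B : ℕ} {n : ℕ → ℕ} (hcut : IsCutSeq N B n) (y : ℕ → ℝ) :
    binCrit y N B n = (1 / (N : ℝ)) * ∑ i ∈ Finset.range N,
      (y i - blockMean y (n (blockIndex B n i)) (n (blockIndex B n i + 1))) ^ 2 := by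
  rw [hcut.sum_range_eq, Finset.mul_sum]
  refine Finset.sum_congr rfl fun b hb => ?_
  have hb' := Finset.mem_range.1 hb
  have hsize : ((n (b + 1) - n b : ℕ) : ℝ) ≠ 0 :=
    Nat.cast_ne_zero.2 (Nat.sub_ne_zero_of_lt (hcut.2.2 b hb'))
  rw [Finset.sum_congr rfl fun i hi => by rw [hcut.blockIndex_eq hb' hi], blockVar,
    div_mul_div_comm, mul_comm (N : ℝ), mul_div_mul_left _ _ hsize, one_div_mul_eq_div]

/-- every consecutive-block partition with nondecreasing block
means has binning criterion at least `(1/N) · ∑ (y i - g* i)²` where `g*` is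
the isotonic least-squares fit of `y`. -/
theorem stmt3 (N B : ℕ) (hN : 1 ≤ N) (hB : 1 ≤ B) (y gs : ℕ → ℝ)
    (hfit : IsIsotonicFit N y gs) (n : ℕ → ℕ) (hcut : IsCutSeq N B n)
    (hmeans : ∀ b, b + 1 < B →
      blockMean y (n b) (n (b + 1)) ≤ blockMean y (n (b + 1)) (n (b + 2))) :
    (1 / (N : ℝ)) * ∑ i ∈ Finset.range N, (y i - gs i) ^ 2 ≤ binCrit y N B n := by
  rw [hcut.binCrit_eq]
  exact mul_le_mul_of_nonneg_left
    (hfit.2 _ (monotoneOnRange_comp_blockIndex n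
      (m := fun b => blockMean y (n b) (n (b + 1))) hB hmeans))
    (by positivity)
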